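/- Let (a_k)_{k≥0} be real numbers whose series converges in the ordinary sense, i.e. the partial sums ∑_{k=0}^{N} a_k converge to a real number L as N → ∞. Then lim_{n→∞} ∑_{k=0}^{n} χ_n(k) a_k = L, where χ_n(j) = n!/(n^j (n−j)!). That is, the summability method Ξ is regular. -/

import Mathlib

open Filter Finset

/-- The coefficient `χ_n(k) = n (n-1) ⋯ (n-k+1) / n^k`, which vanishes for `k > n`. -/
noncomputable def chi (n k : ℕ) : ℝ := (n.descFactorial k : ℝ) / (n : ℝ) ^ k

lemma chi_eq_factorial_div {n k : ℕ} (h : k ≤ n) :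
    chi n k = (n.factorial : ℝ) / ((n : ℝ) ^ k * ((n - k).factorial : ℝ)) := by
  have hf : ((n - k).factorial : ℝ) ≠ 0 := by positivity
  rw [chi, ← Nat.factorial_mul_descFactorial h, Nat.cast_mul, mul_comm ((n : ℝ) ^ k),
    mul_div_mul_left _ _ hf]

lemma chi_zero_right (n : ℕ) : chi n 0 = 1 := by simp [chi]

lemma chi_self_succ (n : ℕ) : chi n (n + 1) = 0 := by
  simp [chi]

lemma chi_nonneg (n k : ℕ) : 0 ≤ chi n k := by unfold chi; positivity

lemma chi_le_one (n k : ℕ) : chi n k ≤ 1 := by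
  unfold chi
  apply div_le_one_of_le₀ _ (by positivity)
  exact_mod_cast Nat.descFactorial_le_pow n k

lemma chi_sub_chi_succ {n k : ℕ} (hn : 0 < n) (h : k ≤ n) :
    chi n k - chi n (k + 1) = chi n k * (k / n) := by
  have hn' : (n : ℝ) ≠ 0 := by positivity
  rw [chi, chi, Nat.descFactorial_succ, Nat.cast_mul, Nat.cast_sub h]
  field_simp
  ring

/-- Summation by parts, for weights `c`. -/
lemma sum_mul_eq_sum_sub_mul_partialSum (c a : ℕ → ℝ) (m : ℕ) :
    ∑ k ∈ range m, c k * a k =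
      ∑ k ∈ range m, (c k - c (k + 1)) * ∑ i ∈ range (k + 1), a i
        + c m * ∑ i ∈ range m, a i := by
  induction m with
  | zero => simp
  | succ m ih =>
    rw [sum_range_succ, ih, sum_range_succ (fun k => (c k - c (k + 1)) * _) m,
      sum_range_succ a m]
    ring

/-- Regularity of the summability method Ξ: if the partial sums `∑_{k=0}^{N} a_k` converge to
`L`, then `∑_{k=0}^{n} χ_n(k) a_k → L` as `n → ∞`, where `χ_n(j) = n!/(n^j (n-j)!)`. -/
theorem stmt_5 (a : ℕ → ℝ) (L : ℝ)
    (hconv : Tendsto (fun N : ℕ => ∑ k ∈ Finset.range (N + 1), a k) atTop (nhds L)) :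
    Tendsto (fun n : ℕ => ∑ k ∈ Finset.range (n + 1),
        (n.factorial : ℝ) / ((n : ℝ) ^ k * ((n - k).factorial : ℝ)) * a k)
      atTop (nhds L) := by
  set S : ℕ → ℝ := fun N => ∑ k ∈ range (N + 1), a k with hS
  have hsum : ∀ n : ℕ, ∑ k ∈ range (n + 1),
      (n.factorial : ℝ) / ((n : ℝ) ^ k * ((n - k).factorial : ℝ)) * a k - L =
      ∑ k ∈ range (n + 1), (chi n k - chi n (k + 1)) * (S k - L) := by
    intro n
    have h1 : ∑ k ∈ range (n + 1),
        (n.factorial : ℝ) / ((n : ℝ) ^ k * ((n - k).factorial : ℝ)) * a k =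
        ∑ k ∈ range (n + 1), chi n k * a k :=
      sum_congr rfl fun k hk => by
        rw [chi_eq_factorial_div (Nat.lt_succ_iff.mp (mem_range.mp hk))]
    rw [h1, sum_mul_eq_sum_sub_mul_partialSum, chi_self_succ, zero_mul, add_zero]
    simp_rw [mul_sub]
    rw [sum_sub_distrib, ← sum_mul, sum_range_sub', chi_zero_right, chi_self_succ, sub_zero,
      one_mul]
  rw [Metric.tendsto_atTop] at hconv ⊢
  intro ε hε
  obtain ⟨K, hK⟩ := hconv (ε / 2) (half_pos hε)
  set C : ℝ := ∑ k ∈ range K, k * |S k - L| with hC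
  obtain ⟨N, hN⟩ := exists_nat_gt (C / (ε / 2))
  refine ⟨max (max N K) 1, fun n hn => ?_⟩
  have hnN : N ≤ n := by omega
  have hnK : K ≤ n + 1 := by omega
  have hn0 : 0 < n := by omega
  have hn0' : (0 : ℝ) < n := by exact_mod_cast hn0
  have hCn : C / n < ε / 2 := by
    rw [div_lt_iff₀ hn0', mul_comm, ← div_lt_iff₀ (half_pos hε)]
    exact hN.trans_le (by exact_mod_cast hnN)
  have hw : ∀ k ∈ range (n + 1), 0 ≤ chi n k - chi n (k + 1) ∧
      chi n k - chi n (k + 1) ≤ k / n := by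
    intro k hk
    rw [chi_sub_chi_succ hn0 (Nat.lt_succ_iff.mp (mem_range.mp hk))]
    exact ⟨mul_nonneg (chi_nonneg n k) (by positivity),
      mul_le_of_le_one_left (by positivity) (chi_le_one n k)⟩
  have hwsum : ∑ k ∈ range (n + 1), (chi n k - chi n (k + 1)) = 1 := by
    rw [sum_range_sub', chi_zero_right, chi_self_succ, sub_zero]
  have hhead : ∑ k ∈ range (n + 1), (if k < K then k * |S k - L| / n else 0) = C / n := by
    rw [← sum_filter, hC, sum_div]
    refine sum_congr ?_ fun _ _ => rfl
    ext k
    simp only [mem_filter, mem_range]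
    omega
  rw [Real.dist_eq, hsum n]
  calc |∑ k ∈ range (n + 1), (chi n k - chi n (k + 1)) * (S k - L)|
      ≤ ∑ k ∈ range (n + 1), |(chi n k - chi n (k + 1)) * (S k - L)| := abs_sum_le_sum_abs _ _
    _ ≤ ∑ k ∈ range (n + 1), ((if k < K then k * |S k - L| / n else 0)
          + (chi n k - chi n (k + 1)) * (ε / 2)) := by
        refine sum_le_sum fun k hk => ?_
        obtain ⟨h0, h1⟩ := hw k hk
        rw [abs_mul, abs_of_nonneg h0]
        split_ifs with hkK
        · have h2 := mul_le_mul_of_nonneg_right h1 (abs_nonneg (S k - L))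
          rw [div_mul_eq_mul_div] at h2
          exact h2.trans (le_add_of_nonneg_right (mul_nonneg h0 (half_pos hε).le))
        · rw [zero_add]
          exact mul_le_mul_of_nonneg_left (hK k (not_lt.mp hkK)).le h0
    _ = C / n + ε / 2 := by rw [sum_add_distrib, hhead, ← sum_mul, hwsum, one_mul]
    _ < ε := by linarith
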